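/- Let T be a basic support τ-tilting Λ-module. (1) If T ≤ Z_i for every i ∈ Q_0, then T = 0. (2) If T ≥ X_i for every i ∈ Q_0, then T = Λ. -/

import Mathlib

/-!
Common framework for formalizing statements from
"From support τ-tilting posets to algebras" (R. Kase).

Modules over the basic finite dimensional algebra `Λ` are taken to be *right*
modules, encoded as (left) modules over the opposite ring `Λᵐᵒᵖ`.
τ-rigidity is encoded through the Auslander–Smalø criterion:
`Hom(M, τM) = 0` iff `Ext¹(M, Fac M) = 0`, and the vanishing of `Ext¹(M, X)`
is encoded by the splitting of all short exact sequences `0 → X → E → M → 0`.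
-/

open MulOpposite

namespace TauTilting

/-- Bundled modules over `A` (in `Type 0`). -/
abbrev Mdl (A : Type) [Ring A] := ModuleCat.{0} A

variable {A B : Type} [Ring A] [Ring B]

/-- `X ∈ Fac M` : `X` is a factor of a finite direct sum of copies of `M`. -/
def MemFac (M X : Mdl A) : Prop :=
  ∃ (n : ℕ) (f : (Fin n → M) →ₗ[A] X), Function.Surjective f

/-- Every short exact sequence `0 → X → E → M → 0` splits, i.e. `Ext¹(M, X) = 0`. -/
def Ext1Vanish (M X : Mdl A) : Prop :=
  ∀ (E : Mdl A) (f : X →ₗ[A] E) (g : E →ₗ[A] M),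
    Function.Injective f → Function.Surjective g →
    LinearMap.range f = LinearMap.ker g →
    ∃ s : M →ₗ[A] E, g.comp s = LinearMap.id

/-- `M` is τ-rigid (Auslander–Smalø: `Hom(M, τM) = 0 ↔ Ext¹(M, Fac M) = 0`). -/
def IsTauRigid (M : Mdl A) : Prop :=
  Module.Finite A M ∧ ∀ X : Mdl A, MemFac M X → Ext1Vanish M X

/-- `M` is indecomposable. -/
def IsIndec (M : Mdl A) : Prop :=
  Nontrivial M ∧ ∀ N N' : Submodule A M, IsCompl N N' → N = ⊥ ∨ N' = ⊥

/-- `F` is an (internal) decomposition of `M` into indecomposable direct summands. -/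
def IsDecompOf (M : Mdl A) {n : ℕ} (F : Fin n → Submodule A M) : Prop :=
  iSupIndep F ∧ iSup F = ⊤ ∧ ∀ k, IsIndec (ModuleCat.of A (F k))

/-- `|M| = n` : `M` decomposes into `n` indecomposable direct summands. -/
def HasNumSummands (M : Mdl A) (n : ℕ) : Prop :=
  ∃ F : Fin n → Submodule A M, IsDecompOf M F

/-- `M` is basic: its indecomposable direct summands are pairwise non-isomorphic. -/
def IsBasicMod (M : Mdl A) : Prop :=
  ∃ (n : ℕ) (F : Fin n → Submodule A M), IsDecompOf M F ∧
    ∀ k l : Fin n, k ≠ l → IsEmpty (↥(F k) ≃ₗ[A] ↥(F l))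

def ModIso (M N : Mdl A) : Prop := Nonempty (M ≃ₗ[A] N)

/-- The order on support τ-tilting modules: `M ≤ N ↔ Fac M ⊆ Fac N`. -/
def FacLE (M N : Mdl A) : Prop := ∀ X : Mdl A, MemFac M X → MemFac N X
def FacLT (M N : Mdl A) : Prop := FacLE M N ∧ ¬ FacLE N M
/-- Equality in the poset of iso-classes: mutual `≤`. -/
def PE (M N : Mdl A) : Prop := FacLE M N ∧ FacLE N M

/-- `N` is a direct summand of `M`. -/
def IsSummand (N M : Mdl A) : Prop :=
  ∃ (f : N →ₗ[A] M) (g : M →ₗ[A] N), g.comp f = LinearMap.id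
/-- `N ∈ add M`. -/
def InAdd (N M : Mdl A) : Prop := ∃ n : ℕ, IsSummand N (ModuleCat.of A (Fin n → M))
def HomZero (R M : Mdl A) : Prop := ∀ f : R →ₗ[A] M, f = 0

/-- Direct sum of two bundled modules. -/
def dsum (M N : Mdl A) : Mdl A := ModuleCat.of A (M × N)

/-- Hasse-quiver arrow `M → N` (so `N` is a direct successor of `M`, and `M` a
direct predecessor of `N`) in the poset of all modules satisfying `P`,
ordered by `FacLE`. -/
def HArrow (P : Mdl A → Prop) (M N : Mdl A) : Prop :=
  P M ∧ P N ∧ FacLT N M ∧ ∀ C, P C → FacLT N C → FacLT C M → False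

def IsMaxOf (P : Mdl A → Prop) (T : Mdl A) : Prop := P T ∧ ∀ S, P S → FacLE S T
def IsMinOf (P : Mdl A → Prop) (T : Mdl A) : Prop := P T ∧ ∀ S, P S → FacLE T S

/-- `T` has exactly `n` direct successors (counted up to poset equality). -/
def SuccsCard (P : Mdl A → Prop) (T : Mdl A) (n : ℕ) : Prop :=
  ∃ g : Fin n → Mdl A, (∀ k, HArrow P T (g k)) ∧
    (∀ k l, k ≠ l → ¬ PE (g k) (g l)) ∧ ∀ S, HArrow P T S → ∃ k, PE S (g k)

/-- `T` has exactly `n` direct predecessors (counted up to poset equality). -/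
def PredsCard (P : Mdl A → Prop) (T : Mdl A) (n : ℕ) : Prop :=
  ∃ g : Fin n → Mdl A, (∀ k, HArrow P (g k) T) ∧
    (∀ k l, k ≠ l → ¬ PE (g k) (g l)) ∧ ∀ S, HArrow P S T → ∃ k, PE S (g k)

/-- The poset of modules satisfying `P` (ordered by `FacLE`) is a lattice. -/
def IsLatticeP (P : Mdl A → Prop) : Prop :=
  ∀ M N, P M → P N →
    (∃ J, P J ∧ FacLE M J ∧ FacLE N J ∧ ∀ C, P C → FacLE M C → FacLE N C → FacLE J C) ∧
    (∃ W, P W ∧ FacLE W M ∧ FacLE W N ∧ ∀ C, P C → FacLE C M → FacLE C N → FacLE C W)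

/-- A poset isomorphism between the posets (of isomorphism classes) of modules
satisfying `PA` resp. `PB`, ordered by `FacLE`. -/
structure PosetIsoP (PA : Mdl A → Prop) (PB : Mdl B → Prop) where
  toFun : Mdl A → Mdl B
  invFun : Mdl B → Mdl A
  maps : ∀ M, PA M → PB (toFun M)
  maps' : ∀ N, PB N → PA (invFun N)
  le_iff : ∀ M N, PA M → PA N → (FacLE M N ↔ FacLE (toFun M) (toFun N))
  le_iff' : ∀ M N, PB M → PB N → (FacLE M N ↔ FacLE (invFun M) (invFun N))
  left_inv : ∀ M, PA M → PE (invFun (toFun M)) M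
  right_inv : ∀ N, PB N → PE (toFun (invFun N)) N

/-- A poset isomorphism between the poset of modules satisfying `P` and an
abstract poset `(β, le)`. -/
structure PosetIsoTo (P : Mdl A → Prop) (β : Type) (le : β → β → Prop) where
  toFun : Mdl A → β
  invFun : β → Mdl A
  maps' : ∀ b, P (invFun b)
  le_iff : ∀ M N, P M → P N → (FacLE M N ↔ le (toFun M) (toFun N))
  left_inv : ∀ M, P M → PE (invFun (toFun M)) M
  right_inv : ∀ b, toFun (invFun b) = b

/-! ### Ring-level notions -/

variable (Λ : Type) [Ring Λ]

/-- The right ideal generated by a subset, as a right module (i.e. `Λᵐᵒᵖ`-module). -/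
def rSpan (S : Set Λ) : Submodule Λᵐᵒᵖ Λ := Submodule.span Λᵐᵒᵖ S
/-- The two-sided ideal `(q) = ΛqΛ`, as a right `Λ`-module. -/
def tIdeal (q : Λ) : Submodule Λᵐᵒᵖ Λ := Submodule.span Λᵐᵒᵖ {y : Λ | ∃ a : Λ, y = a * q}
/-- The right `Λ`-module `Λ/S`. -/
def quotMod (S : Submodule Λᵐᵒᵖ Λ) : Mdl Λᵐᵒᵖ := ModuleCat.of Λᵐᵒᵖ (Λ ⧸ S)
/-- `Λ` as a right module over itself. -/
def regMod : Mdl Λᵐᵒᵖ := ModuleCat.of Λᵐᵒᵖ Λ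
/-- The projective right module `xΛ ≅ Λ/(1-x)Λ` attached to an idempotent `x`. -/
def projMod (x : Λ) : Mdl Λᵐᵒᵖ := quotMod Λ (rSpan Λ {1 - x})
/-- The right `Λ`-module `Λ/(1-x)`; for `x = e i` this is the module `X_i`. -/
def cyclicQuot (x : Λ) : Mdl Λᵐᵒᵖ := quotMod Λ (tIdeal Λ (1 - x))

/-- `x` is a primitive idempotent. -/
def IsPrimIdem (x : Λ) : Prop :=
  IsIdempotentElem x ∧ x ≠ 0 ∧
    ∀ a b : Λ, IsIdempotentElem a → IsIdempotentElem b →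
      a * b = 0 → b * a = 0 → a + b = x → a = 0 ∨ b = 0

variable {ι : Type} [Fintype ι]

/-- `e` is a complete family of orthogonal primitive idempotents of `Λ`. -/
def CompletePrimIdems (e : ι → Λ) : Prop :=
  (∀ i, IsPrimIdem Λ (e i)) ∧ (Pairwise fun i j => e i * e j = 0) ∧ ∑ i, e i = 1

/-- `Λ` is basic w.r.t. `e`: the `e i Λ` are pairwise non-isomorphic. -/
def IsBasicAlg (e : ι → Λ) : Prop :=
  ∀ i j : ι, i ≠ j → IsEmpty (↥(projMod Λ (e i)) ≃ₗ[Λᵐᵒᵖ] ↥(projMod Λ (e j)))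

/-- The support `supp(M) = {i | M·eᵢ ≠ 0}` of a right module `M`. -/
def Supp (e : ι → Λ) (M : Mdl Λᵐᵒᵖ) : Set ι := {i | ∃ m : M, op (e i) • m ≠ 0}

/-- Support τ-tilting module: τ-rigid with `|M| = #supp(M)`. -/
def IsSTT (e : ι → Λ) (M : Mdl Λᵐᵒᵖ) : Prop :=
  Module.Finite Λᵐᵒᵖ M ∧ IsTauRigid M ∧ HasNumSummands M (Supp Λ e M).ncard

/-- Basic support τ-tilting module. -/
def IsBSTT (e : ι → Λ) (M : Mdl Λᵐᵒᵖ) : Prop := IsSTT Λ e M ∧ IsBasicMod M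

/-- τ-tilting module: τ-rigid with `|M| = #Q₀`. -/
def IsTauTiltingMod (e : ι → Λ) (M : Mdl Λᵐᵒᵖ) : Prop :=
  IsSTT Λ e M ∧ HasNumSummands M (Fintype.card ι)

open scoped Classical in
/-- The idempotent `1 - e_M = Σ_{i ∉ supp M} e i`. -/
noncomputable def cIdem (e : ι → Λ) (M : Mdl Λᵐᵒᵖ) : Λ :=
  ∑ i : ι, if i ∈ Supp Λ e M then 0 else e i

/-- τ-rigid pair `(M, P)`. -/
def IsTauRigidPair (e : ι → Λ) (M P : Mdl Λᵐᵒᵖ) : Prop :=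
  IsTauRigid M ∧ Module.Finite Λᵐᵒᵖ P ∧ Module.Projective Λᵐᵒᵖ P ∧
    InAdd P (projMod Λ (cIdem Λ e M))

/-- Basic τ-rigid pair. -/
def IsBasicTRP (e : ι → Λ) (M P : Mdl Λᵐᵒᵖ) : Prop :=
  IsTauRigidPair Λ e M P ∧ IsBasicMod M ∧ IsBasicMod P

/-- `T ∈ sτtilt_{(N,R)} Λ`, i.e. `N ∈ add T` and `Hom(R, T) = 0`. -/
def InPairSet (N R T : Mdl Λᵐᵒᵖ) : Prop := InAdd N T ∧ HomZero R T

/-- `Λ` is τ-tilting finite: finitely many basic support τ-tilting modules up to iso. -/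
def TauTiltingFinite (e : ι → Λ) : Prop :=
  ∃ (n : ℕ) (T : Fin n → Mdl Λᵐᵒᵖ), ∀ M, IsBSTT Λ e M → ∃ k, ModIso M (T k)

/-- The Jacobson radical of `Λ`, as a `K`-subspace. -/
noncomputable def radK (K : Type) [CommRing K] (Λ : Type) [Ring Λ] [Algebra K Λ] :
    Submodule K Λ :=
  Submodule.restrictScalars K (sInf {I : Ideal Λ | I.IsMaximal})

/-- Powers of the radical, with `rad⁰ = Λ`. -/
noncomputable def radPow (K : Type) [CommRing K] (Λ : Type) [Ring Λ] [Algebra K Λ] :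
    ℕ → Submodule K Λ
  | 0 => ⊤
  | n + 1 => radK K Λ ^ (n + 1)

/-! ### Quivers, paths and presentations -/

/-- Paths in a quiver with vertex set `ι` and arrow types `Arr i j`. -/
inductive QPath {ι : Type} (Arr : ι → ι → Type) : ι → ι → Type
  | nil (i : ι) : QPath Arr i i
  | cons {i j k : ι} (a : Arr i j) (p : QPath Arr j k) : QPath Arr i k

namespace QPath

variable {ι : Type} {Arr : ι → ι → Type}

/-- The list of visited vertices. -/
def verts : ∀ {i j : ι}, QPath Arr i j → List ι
  | i, _, .nil _ => [i]
  | i, _, .cons _ p => i :: p.verts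

/-- Evaluation of a path in the algebra `Λ` (trivial path at `i` ↦ `e i`). -/
def eval {Λ : Type} [Ring Λ] (e : ι → Λ) (arr : ∀ i j, Arr i j → Λ) :
    ∀ {i j : ι}, QPath Arr i j → Λ
  | _, _, .nil i => e i
  | _, _, .cons a p => arr _ _ a * p.eval e arr

def append : ∀ {i j k : ι}, QPath Arr i j → QPath Arr j k → QPath Arr i k
  | _, _, _, .nil _, q => q
  | _, _, _, .cons a p, q => .cons a (p.append q)

def single {i j : ι} (a : Arr i j) : QPath Arr i j := .cons a (.nil j)

end QPath

/-- The condition `xΛe_j = e_iΛe_j = e_iΛx ≠ 0` on an element `x` of `e_iΛe_j`. -/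
def Gcond (ei ej x : Λ) : Prop :=
  (Set.range fun b => x * b * ej) = (Set.range fun b => ei * b * ej) ∧
  (Set.range fun b => ei * b * x) = (Set.range fun b => ei * b * ej) ∧
  ∃ b, ei * b * ej ≠ 0

/-- `w ∈ G(Q, I)` : `w` contains no cycle as a subpath (equivalently, visits no
vertex twice) and `wΛe_j = e_iΛe_j = e_iΛw ≠ 0`. -/
def GMem (e : ι → Λ) {Arr : ι → ι → Type} (arr : ∀ i j, Arr i j → Λ) {i j : ι}
    (w : QPath Arr i j) : Prop :=
  w.verts.Nodup ∧ Gcond Λ (e i) (e j) (w.eval e arr)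

/-- Condition 1 for a bound quiver: if `e_iΛe_j ≠ 0` then `G^i_j ≠ ∅`. -/
def Cond1 (e : ι → Λ) {Arr : ι → ι → Type} (arr : ∀ i j, Arr i j → Λ) : Prop :=
  ∀ i j : ι, (∃ x, e i * x * e j ≠ 0) → ∃ w : QPath Arr i j, GMem Λ e arr w

/-- Ring-level version of Condition 1 (Lemma `eqcd` (iii)). -/
def Cond1R : Prop :=
  ∀ x y : Λ, IsPrimIdem Λ x → IsPrimIdem Λ y → x * y = 0 → y * x = 0 →
    ∃ w : Λ, (∃ b, w = x * b * y) ∧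
      (Set.range fun b => w * b * y) = (Set.range fun b => x * b * y) ∧
      (Set.range fun b => x * b * w) = (Set.range fun b => x * b * y)

/-- `(e, Arr, arr)` presents `Λ` as the bound quiver algebra `KQ/I` with `Q` its
Gabriel quiver: `e` is a complete family of orthogonal primitive idempotents,
`Λ` is basic, each arrow `a : i → j` is sent to an element of `e_i (rad Λ) e_j`,
and the arrows form a `K`-basis of `rad Λ / rad² Λ`. -/
def IsGabrielPres (K : Type) [Field K] [Algebra K Λ] [DecidableEq ι] (e : ι → Λ)
    (Arr : ι → ι → Type) [∀ i j, Fintype (Arr i j)] (arr : ∀ i j, Arr i j → Λ) : Prop :=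
  CompletePrimIdems Λ e ∧ IsBasicAlg Λ e ∧
  (∀ i j (a : Arr i j), arr i j a ∈ radK K Λ ∧ e i * arr i j a * e j = arr i j a) ∧
  (radK K Λ ≤
    Submodule.span K (Set.range fun p : Σ i : ι, Σ j : ι, Arr i j => arr p.1 p.2.1 p.2.2) ⊔
      radK K Λ * radK K Λ) ∧
  (∀ c : (Σ i : ι, Σ j : ι, Arr i j) → K,
    (∑ p : Σ i : ι, Σ j : ι, Arr i j, c p • arr p.1 p.2.1 p.2.2) ∈ radK K Λ * radK K Λ →
    ∀ p, c p = 0)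

/-! ### Partitions of a quiver, Condition 2 -/

/-- `x` and `y` are adjacent within the vertex subset `S` (undirected). -/
def AdjIn {ι : Type} (Arr : ι → ι → Type) (S : Set ι) (x y : ι) : Prop :=
  x ∈ S ∧ y ∈ S ∧ (Nonempty (Arr x y) ∨ Nonempty (Arr y x))

/-- The full subquiver on `S` is connected. -/
def ConnectedOn {ι : Type} (Arr : ι → ι → Type) (S : Set ι) : Prop :=
  ∀ x ∈ S, ∀ y ∈ S, Relation.ReflTransGen (AdjIn Arr S) x y

/-- Adjacency of parts in the quotient quiver `Q^μ`. -/
def PartAdj {ι : Type} (Arr : ι → ι → Type) {ℓ : ℕ} (μ : ι → Fin ℓ) (u v : Fin ℓ) : Prop :=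
  u ≠ v ∧ ∃ x y, μ x = u ∧ μ y = v ∧ (Nonempty (Arr x y) ∨ Nonempty (Arr y x))

/-- Condition 2: there is a partition `μ` of `Q₀` into connected full subquivers
such that `Q^μ` is a tree (connected with `#arrows = #parts - 1`) and each
`sτtilt Λ^{a,b}_μ` — identified with the subposet of `sτtilt Λ` of modules
supported on the union of the two parts — is a lattice. -/
def Cond2 (e : ι → Λ) (Arr : ι → ι → Type) [∀ i j, Fintype (Arr i j)] : Prop :=
  ∃ (ℓ : ℕ) (μ : ι → Fin ℓ), Function.Surjective μ ∧
    (∀ a : Fin ℓ, ConnectedOn Arr {i | μ i = a}) ∧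
    (∀ u v : Fin ℓ, Relation.ReflTransGen (PartAdj Arr μ) u v) ∧
    Nat.card {p : Σ i : ι, Σ j : ι, Arr i j // μ p.1 ≠ μ p.2.1} = ℓ - 1 ∧
    ∀ a b : Fin ℓ, a ≠ b →
      IsLatticeP (fun T : Mdl Λᵐᵒᵖ => IsBSTT Λ e T ∧ Supp Λ e T ⊆ {i | μ i = a ∨ μ i = b})

/-! ### Correspondence of paths under a quiver isomorphism, and `∼` -/

/-- Transport of paths along a quiver isomorphism `σ : Q° → (Q')°` (defined on
non-loop arrows). -/
inductive PathCorr {ι ι' : Type} {Arr : ι → ι → Type} {Arr' : ι' → ι' → Type}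
    (σ : ι → ι') (σ1 : ∀ i j, i ≠ j → Arr i j → Arr' (σ i) (σ j)) :
    ∀ {i j : ι}, QPath Arr i j → QPath Arr' (σ i) (σ j) → Prop
  | nil (i : ι) : PathCorr σ σ1 (QPath.nil i) (QPath.nil (σ i))
  | cons {i j k : ι} (h : i ≠ j) (a : Arr i j) {p : QPath Arr j k}
      {p' : QPath Arr' (σ j) (σ k)} :
      PathCorr σ σ1 p p' → PathCorr σ σ1 (QPath.cons a p) (QPath.cons (σ1 i j h a) p')

/-- The relation `(Q, I) ∼ (Q', I')`: there is a quiver isomorphism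
`σ : Q° → (Q')°` with (a) `supp(e_{σ(i)}Γ) = σ(supp(e_iΛ))` and (b) `G(Γ) = σ(G(Λ))`. -/
def SimCond {Λ Γ : Type} [Ring Λ] [Ring Γ] {ι ι' : Type}
    (e : ι → Λ) {Arr : ι → ι → Type} (arr : ∀ i j, Arr i j → Λ)
    (f : ι' → Γ) {Arr' : ι' → ι' → Type} (arr' : ∀ i j, Arr' i j → Γ) : Prop :=
  ∃ (σ : ι ≃ ι') (σ1 : ∀ i j, i ≠ j → (Arr i j ≃ Arr' (σ i) (σ j))),
    (∀ i j : ι, (∃ x, e i * x * e j ≠ 0) ↔ ∃ y, f (σ i) * y * f (σ j) ≠ 0) ∧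
    (∀ (i j : ι) (w : QPath Arr i j), GMem Λ e arr w →
      ∃ w' : QPath Arr' (σ i) (σ j),
        PathCorr σ (fun i j h => σ1 i j h) w w' ∧ GMem Γ f arr' w') ∧
    (∀ (i j : ι) (w' : QPath Arr' (σ i) (σ j)), GMem Γ f arr' w' →
      ∃ w : QPath Arr i j,
        PathCorr σ (fun i j h => σ1 i j h) w w' ∧ GMem Λ e arr w)

end TauTilting

namespace TauTilting

section Modules

variable {A : Type} [Ring A]

theorem MemFac.of_surjective {M X Y : Mdl A} (h : MemFac M X) (f : X →ₗ[A] Y)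
    (hf : Function.Surjective f) : MemFac M Y := by
  obtain ⟨n, g, hg⟩ := h
  exact ⟨n, f.comp g, hf.comp hg⟩

theorem memFac_of_fintype {M X : Mdl A} {α : Type} [Fintype α] (f : (α → M) →ₗ[A] X)
    (hf : Function.Surjective f) : MemFac M X :=
  ⟨Fintype.card α, f.comp (LinearEquiv.funCongrLeft A M (Fintype.equivFin α)).toLinearMap,
    hf.comp (LinearEquiv.surjective _)⟩

theorem MemFac.refl (M : Mdl A) : MemFac M M :=
  memFac_of_fintype (α := Unit) (LinearMap.proj ()) fun m => ⟨fun _ => m, rfl⟩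

theorem MemFac.finite {M X : Mdl A} [Module.Finite A M] (h : MemFac M X) :
    Module.Finite A X := by
  obtain ⟨n, g, hg⟩ := h
  exact Module.Finite.of_surjective g hg

theorem MemFac.trans {M X Y : Mdl A} (h : MemFac M X) (h' : MemFac X Y) : MemFac M Y := by
  obtain ⟨n, g, hg⟩ := h
  obtain ⟨m, f, hf⟩ := h'
  refine memFac_of_fintype (α := Fin m × Fin n)
    ((f.comp (g.compLeft (Fin m))).comp
      (LinearEquiv.curry A M (Fin m) (Fin n)).toLinearMap) ?_
  refine (hf.comp fun v => ?_).comp (LinearEquiv.surjective _)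
  choose w hw using fun t => hg (v t)
  exact ⟨w, funext hw⟩

theorem MemFac.pi {M : Mdl A} {α : Type} [Fintype α] {N : α → Mdl A}
    (h : ∀ a, MemFac M (N a)) : MemFac M (ModuleCat.of A (∀ a, N a)) := by
  choose n f hf using h
  refine memFac_of_fintype (α := Σ a, Fin (n a))
    (LinearMap.pi fun a => (f a).comp
      (LinearMap.funLeft A M fun t => (⟨a, t⟩ : Σ a, Fin (n a)))) fun v => ?_
  choose w hw using fun a => hf a (v a)
  exact ⟨fun p => w p.1 p.2, funext hw⟩

theorem MemFac.facLE {M N : Mdl A} (h : MemFac M N) : FacLE N M := fun _ hX => h.trans hX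

/-- If `Ext¹(T, X) = 0`, maps from `T` lift along surjections with kernel `X`. -/
theorem Ext1Vanish.lift {T X B C : Mdl A} (h : Ext1Vanish T X) (i : X →ₗ[A] B)
    (p : B →ₗ[A] C) (hi : Function.Injective i) (hp : Function.Surjective p)
    (hip : LinearMap.range i = LinearMap.ker p) (φ : T →ₗ[A] C) :
    ∃ ψ : T →ₗ[A] B, p.comp ψ = φ := by
  let E : Submodule A (B × T) :=
    LinearMap.ker (p.comp (LinearMap.fst A B T) - φ.comp (LinearMap.snd A B T))
  have hE : ∀ z : B × T, z ∈ E ↔ p z.1 = φ z.2 := fun z => by simp [E, sub_eq_zero]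
  have hpi : ∀ x, p (i x) = 0 := fun x => by
    rw [← LinearMap.mem_ker, ← hip]; exact LinearMap.mem_range_self i x
  let f : X →ₗ[A] E := ((LinearMap.inl A B T).comp i).codRestrict E
    fun x => by simp [hE, hpi]
  let g : E →ₗ[A] T := (LinearMap.snd A B T).comp E.subtype
  obtain ⟨s, hs⟩ := h (ModuleCat.of A E) f g
    (fun x y hxy => hi (congrArg (fun z : E => z.1.1) hxy))
    (fun t => by
      obtain ⟨b, hb⟩ := hp (φ t)
      exact ⟨⟨(b, t), (hE _).2 hb⟩, rfl⟩)
    (by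
      ext z
      constructor
      · rintro ⟨x, rfl⟩
        rfl
      · intro hz
        have hz2 : z.1.2 = 0 := hz
        have hz1 : p z.1.1 = 0 := by rw [(hE z.1).1 z.2, hz2, map_zero]
        rw [← LinearMap.mem_ker, ← hip] at hz1
        obtain ⟨x, hx⟩ := hz1
        exact ⟨x, Subtype.ext (Prod.ext hx hz2.symm)⟩)
  refine ⟨((LinearMap.fst A B T).comp E.subtype).comp s, LinearMap.ext fun t => ?_⟩
  have h1 := (hE (s t).1).1 (s t).2
  have h2 : (s t).1.2 = t := LinearMap.congr_fun hs t
  rw [h2] at h1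
  exact h1

/-- The factor modules of a τ-rigid module are closed under extensions. -/
theorem IsTauRigid.memFac_of_exact {T X B C : Mdl A} (hT : IsTauRigid T) (i : X →ₗ[A] B)
    (p : B →ₗ[A] C) (hi : Function.Injective i) (hp : Function.Surjective p)
    (hip : LinearMap.range i = LinearMap.ker p) (hX : MemFac T X) (hC : MemFac T C) :
    MemFac T B := by
  have hext := hT.2 X hX
  obtain ⟨n, f, hf⟩ := hX
  obtain ⟨m, g, hg⟩ := hC
  choose ψ hψ using fun t : Fin m =>
    hext.lift i p hi hp hip (g.comp (LinearMap.single A (fun _ => T) t))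
  let Ψ : (Fin m → T) →ₗ[A] B := LinearMap.lsum A (fun _ => T) ℕ ψ
  have hΨ : p.comp Ψ = g := by
    refine LinearMap.pi_ext' fun t => ?_
    rw [← hψ t]
    exact LinearMap.ext fun x => congrArg p (LinearMap.lsum_piSingle A _ ℕ ψ t x)
  refine memFac_of_fintype (α := Fin m ⊕ Fin n)
    (Ψ.comp (LinearMap.funLeft A T Sum.inl) +
      (i.comp f).comp (LinearMap.funLeft A T Sum.inr)) fun b => ?_
  obtain ⟨u, hu⟩ := hg (p b)
  have hk : b - Ψ u ∈ LinearMap.range i := by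
    rw [hip, LinearMap.mem_ker, map_sub, ← LinearMap.comp_apply, hΨ, hu, sub_self]
  obtain ⟨x, hx⟩ := hk
  obtain ⟨v, rfl⟩ := hf x
  refine ⟨Sum.elim u v, ?_⟩
  have h1 : (LinearMap.funLeft A T Sum.inl) (Sum.elim u v) = u := rfl
  have h2 : (LinearMap.funLeft A T Sum.inr) (Sum.elim u v) = v := rfl
  simp [h1, h2, hx]

/-- A τ-rigid module generating all simple modules generates all finite modules. -/
theorem IsTauRigid.memFac_of_forall_simple [IsArtinianRing A] {T : Mdl A} (hT : IsTauRigid T)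
    (hS : ∀ S : Mdl A, IsSimpleModule A S → MemFac T S) (M : Mdl A) [Module.Finite A M] :
    MemFac T M := by
  have : IsCoatomic (Submodule A M) := inferInstance
  obtain ⟨L, hL, hmin⟩ := WellFounded.has_min (wellFounded_lt (α := Submodule A M))
    {L | MemFac T (ModuleCat.of A (M ⧸ L))}
    ⟨⊤, 0, 0, fun x => ⟨0, Subsingleton.elim (α := M ⧸ (⊤ : Submodule A M)) _ _⟩⟩
  by_cases hL0 : L = ⊥
  · subst hL0
    exact MemFac.of_surjective hL (Submodule.quotEquivOfEqBot ⊥ rfl).toLinearMap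
      (LinearEquiv.surjective _)
  exfalso
  have : Nontrivial L := Submodule.nontrivial_iff_ne_bot.2 hL0
  obtain ⟨N, hN, -⟩ := (eq_top_or_exists_le_coatom (⊥ : Submodule A L)).resolve_left bot_ne_top
  have hNL : N.map L.subtype ≤ L := Submodule.map_subtype_le L N
  have hlt : N.map L.subtype < L := lt_of_le_of_ne hNL fun h => hN.1 <| by
    rw [eq_top_iff]
    intro x _
    have : (x : M) ∈ N.map L.subtype := h.symm.le x.2
    obtain ⟨y, hy, hyx⟩ := this
    exact Subtype.ext hyx ▸ hy
  refine hmin (N.map L.subtype) ?_ hlt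
  have hsimple : IsSimpleModule A (L ⧸ N) := isSimpleModule_iff_isCoatom.2 hN
  refine hT.memFac_of_exact (X := ModuleCat.of A (L ⧸ N))
    (C := ModuleCat.of A (M ⧸ L)) (B := ModuleCat.of A (M ⧸ N.map L.subtype))
    (N.mapQ (N.map L.subtype) L.subtype (Submodule.le_comap_map _ _))
    (Submodule.factor hNL) ?_ (Submodule.factor_surjective hNL) ?_ (hS _ hsimple) hL
  · rw [← LinearMap.ker_eq_bot, Submodule.ker_mapQ]
    rw [Submodule.comap_map_eq_of_injective L.injective_subtype]
    exact Submodule.mkQ_map_self N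
  · ext z
    obtain ⟨z, rfl⟩ := Submodule.mkQ_surjective _ z
    constructor
    · rintro ⟨w, hw⟩
      obtain ⟨w, rfl⟩ := Submodule.mkQ_surjective _ w
      rw [← hw]
      simp
    · intro hz
      have hz' : z ∈ L := by simpa using hz
      exact ⟨Submodule.Quotient.mk ⟨z, hz'⟩, by simp⟩

theorem IsSummand.trans {L M N : Mdl A} (h : IsSummand L M) (h' : IsSummand M N) :
    IsSummand L N := by
  obtain ⟨f, g, hgf⟩ := h
  obtain ⟨f', g', hgf'⟩ := h'
  exact ⟨f'.comp f, g.comp g', LinearMap.ext fun x => by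
    rw [LinearMap.comp_apply, LinearMap.comp_apply, LinearMap.comp_apply,
      ← LinearMap.comp_apply g' f', hgf']
    exact LinearMap.congr_fun hgf x⟩

theorem IsSummand.memFac {M N : Mdl A} (h : IsSummand N M) : MemFac M N := by
  obtain ⟨f, g, hgf⟩ := h
  exact (MemFac.refl M).of_surjective g fun x => ⟨f x, LinearMap.congr_fun hgf x⟩

theorem isSummand_of_isCompl {M : Mdl A} {N N' : Submodule A M} (h : IsCompl N N') :
    IsSummand (ModuleCat.of A N) M :=
  ⟨N.subtype, N.projectionOnto N' h, LinearMap.ext fun x => by simp⟩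

theorem MemFac.isSummand {M P : Mdl A} [Module.Projective A P] (h : MemFac M P) :
    ∃ n : ℕ, IsSummand P (ModuleCat.of A (Fin n → M)) := by
  obtain ⟨n, f, hf⟩ := h
  obtain ⟨s, hs⟩ := Module.projective_lifting_property f LinearMap.id hf
  exact ⟨n, s, f, hs⟩

theorem IsIndec.congr {M N : Mdl A} (h : IsIndec M) (φ : M ≃ₗ[A] N) : IsIndec N := by
  have := h.1
  refine ⟨φ.symm.toEquiv.nontrivial, fun L L' hL => ?_⟩
  have := h.2 _ _ ((Submodule.orderIsoMapComap φ.symm).isCompl hL)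
  simpa [Submodule.map_eq_bot_iff] using this

theorem isCompl_range_ker {M N : Mdl A} {f : N →ₗ[A] M} {g : M →ₗ[A] N}
    (h : g.comp f = LinearMap.id) : IsCompl (LinearMap.range f) (LinearMap.ker g) := by
  have hgf : ∀ x, g (f x) = x := LinearMap.congr_fun h
  constructor
  · rw [Submodule.disjoint_def]
    rintro _ ⟨x, rfl⟩ hx
    rw [← hgf x, LinearMap.mem_ker.1 hx, map_zero]
  · rw [codisjoint_iff, eq_top_iff]
    intro x _
    exact Submodule.mem_sup.2 ⟨f (g x), ⟨g x, rfl⟩, x - f (g x), by simp [hgf], by simp⟩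

/-- An indecomposable summand of an indecomposable module is the whole module. -/
theorem IsSummand.modIso {M N : Mdl A} (h : IsSummand N M) (hM : IsIndec M)
    [Nontrivial N] : ModIso N M := by
  obtain ⟨f, g, hgf⟩ := h
  have hfi : Function.Injective f := fun x y hxy => by
    rw [← LinearMap.id_apply (R := A) x, ← LinearMap.id_apply (R := A) y, ← hgf,
      LinearMap.comp_apply, LinearMap.comp_apply, hxy]
  have hc : IsCompl (LinearMap.range f) (LinearMap.ker g) :=
    isCompl_range_ker hgf
  rcases hM.2 _ _ hc with h | h
  · obtain ⟨x, hx⟩ := exists_ne (0 : N)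
    refine absurd (hfi ?_) hx
    rw [LinearMap.range_eq_bot.1 h]
    rfl
  · have hgi := LinearMap.ker_eq_bot.1 h
    exact ⟨LinearEquiv.ofBijective f ⟨hfi, fun m => ⟨g m, hgi (LinearMap.congr_fun hgf (g m))⟩⟩⟩

section Fitting

variable [IsArtinianRing A]

theorem IsIndec.isUnit_or_isNilpotent {M : Mdl A} (h : IsIndec M) [Module.Finite A M]
    (φ : Module.End A M) : IsUnit φ ∨ IsNilpotent φ := by
  obtain ⟨n, hn⟩ := Filter.eventually_atTop.1 φ.eventually_isCompl_ker_pow_range_pow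
  have hc := hn (n + 1) (Nat.le_succ n)
  rcases h.2 _ _ hc with h0 | h0
  · left
    rw [h0] at hc
    refine (isUnit_pow_iff (Nat.succ_ne_zero n)).1 ((Module.End.isUnit_iff _).2
      ⟨LinearMap.ker_eq_bot.1 h0, LinearMap.range_eq_top.1 ?_⟩)
    exact (eq_top_of_bot_isCompl hc)
  · exact Or.inr ⟨n + 1, LinearMap.range_eq_bot.1 h0⟩

theorem IsIndec.isLocalRing {M : Mdl A} (h : IsIndec M) [Module.Finite A M] :
    IsLocalRing (Module.End A M) := by
  have := h.1
  exact IsLocalRing.of_isUnit_or_isUnit_one_sub_self fun φ =>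
    (h.isUnit_or_isNilpotent φ).imp id fun h => h.isUnit_one_sub

end Fitting

theorem isSummand_of_isUnit_comp {M N : Mdl A} (f : N →ₗ[A] M) (g : M →ₗ[A] N)
    (h : IsUnit (g.comp f : Module.End A N)) : IsSummand N M := by
  obtain ⟨u, hu⟩ := h
  refine ⟨f, (↑u⁻¹ : Module.End A N).comp g, ?_⟩
  rw [LinearMap.comp_assoc, ← hu]
  exact u.inv_mul

/-- A summand with local endomorphism ring of a finite product is a summand of a factor. -/
theorem IsSummand.exists_of_pi {α : Type} [Fintype α] {M : α → Mdl A} {N : Mdl A}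
    [IsLocalRing (Module.End A N)] (h : IsSummand N (ModuleCat.of A (∀ a, M a))) :
    ∃ a, IsSummand N (M a) := by
  classical
  obtain ⟨f, g, hgf⟩ := h
  have hsum : ∑ a, ((g.comp (LinearMap.single A (fun a => M a) a)).comp
      ((LinearMap.proj a).comp f) : Module.End A N) = 1 := by
    refine LinearMap.ext fun x => ?_
    rw [LinearMap.sum_apply]
    simp only [LinearMap.comp_apply, LinearMap.proj_apply, LinearMap.coe_single]
    rw [← map_sum, Finset.univ_sum_single]
    exact LinearMap.congr_fun hgf x
  obtain ⟨a, -, ha⟩ := IsLocalRing.exists_of_isUnit_sum (hsum.symm ▸ isUnit_one)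
  exact ⟨a, isSummand_of_isUnit_comp _ _ ha⟩

/-- A projective module with local endomorphism ring is hollow. -/
theorem eq_top_or_eq_top_of_sup {P : Mdl A} [Module.Projective A P]
    [IsLocalRing (Module.End A P)] {L L' : Submodule A P} (h : L ⊔ L' = ⊤) :
    L = ⊤ ∨ L' = ⊤ := by
  obtain ⟨s, hs⟩ := Module.projective_lifting_property (L.subtype.coprod L'.subtype)
    LinearMap.id (LinearMap.range_eq_top.1 (by simp [LinearMap.range_coprod, h]))
  let φ : Module.End A P := (L.subtype.comp (LinearMap.fst A L L')).comp s
  let ψ : Module.End A P := (L'.subtype.comp (LinearMap.snd A L L')).comp s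
  have hsum : φ + ψ = 1 := by
    refine LinearMap.ext fun x => ?_
    exact LinearMap.congr_fun hs x
  refine (IsLocalRing.isUnit_or_isUnit_of_add_one hsum).imp (fun hu => ?_) fun hu => ?_
  · rw [eq_top_iff]
    intro x _
    obtain ⟨y, rfl⟩ := ((Module.End.isUnit_iff _).1 hu).2 x
    exact (s y).1.2
  · rw [eq_top_iff]
    intro x _
    obtain ⟨y, rfl⟩ := ((Module.End.isUnit_iff _).1 hu).2 x
    exact (s y).2.2

/-- Two simple quotients of a projective module with local endomorphism ring are isomorphic. -/
theorem modIso_of_simple_quotients {P S S' : Mdl A} [Module.Projective A P]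
    [IsLocalRing (Module.End A P)] [IsSimpleModule A S] [IsSimpleModule A S']
    (p : P →ₗ[A] S) (p' : P →ₗ[A] S') (hp : p ≠ 0) (hp' : p' ≠ 0) : ModIso S S' := by
  have hs := LinearMap.surjective_of_ne_zero hp
  have hs' := LinearMap.surjective_of_ne_zero hp'
  have e1 := p.quotKerEquivOfSurjective hs
  have e2 := p'.quotKerEquivOfSurjective hs'
  have c1 : IsCoatom (LinearMap.ker p) := isSimpleModule_iff_isCoatom.1 (IsSimpleModule.congr e1)
  have c2 : IsCoatom (LinearMap.ker p') := isSimpleModule_iff_isCoatom.1 (IsSimpleModule.congr e2)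
  have heq : LinearMap.ker p = LinearMap.ker p' := by
    by_contra hne
    rcases eq_top_or_eq_top_of_sup (c1.sup_eq_top_of_ne c2 hne) with h | h
    · exact c1.1 h
    · exact c2.1 h
  exact ⟨e1.symm.trans ((Submodule.quotEquivOfEq _ _ heq).trans e2)⟩

/-- Indecomposable projective modules with a common simple quotient are isomorphic. -/
theorem modIso_of_common_simple_quotient [IsArtinianRing A] {P P' S : Mdl A}
    [Module.Projective A P] [Module.Projective A P'] [Module.Finite A P]
    (hP : IsIndec P) (hP' : IsIndec P') [IsSimpleModule A S]
    (p : P →ₗ[A] S) (p' : P' →ₗ[A] S) (hp : p ≠ 0) (hp' : p' ≠ 0) : ModIso P P' := by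
  obtain ⟨f, hf⟩ := Module.projective_lifting_property p' p (LinearMap.surjective_of_ne_zero hp')
  obtain ⟨g, hg⟩ := Module.projective_lifting_property p p' (LinearMap.surjective_of_ne_zero hp)
  have := hP.1
  have hcomp : p.comp (g.comp f) = p := by rw [← LinearMap.comp_assoc, hg, hf]
  rcases hP.isUnit_or_isNilpotent (g.comp f) with hu | ⟨n, hn⟩
  · exact (isSummand_of_isUnit_comp f g hu).modIso hP'
  · refine absurd ?_ hp
    have : ∀ m : ℕ, p.comp ((g.comp f : Module.End A P) ^ m) = p := fun m => by
      induction m with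
      | zero => rfl
      | succ m ih => rw [pow_succ', Module.End.mul_eq_comp, ← LinearMap.comp_assoc, hcomp, ih]
    rw [← this n, hn, LinearMap.comp_zero]

theorem exists_simple_quotient (M : Mdl A) [Module.Finite A M] [Nontrivial M] :
    ∃ (S : Mdl A) (p : M →ₗ[A] S), IsSimpleModule A S ∧ Function.Surjective p := by
  obtain ⟨N, hN, -⟩ := (eq_top_or_exists_le_coatom (⊥ : Submodule A M)).resolve_left bot_ne_top
  exact ⟨ModuleCat.of A (M ⧸ N), N.mkQ, isSimpleModule_iff_isCoatom.2 hN, N.mkQ_surjective⟩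

theorem ModIso.isSummand {M N : Mdl A} (h : ModIso M N) : IsSummand M N := by
  obtain ⟨φ⟩ := h
  exact ⟨φ.toLinearMap, φ.symm.toLinearMap, LinearMap.ext fun x => φ.symm_apply_apply x⟩

section Decomposition

theorem isDecompOf_pi {α : Type} [DecidableEq α] {M : α → Mdl A}
    (h : ∀ a, IsIndec (M a)) {n : ℕ} (σ : Fin n ≃ α) :
    IsDecompOf (ModuleCat.of A (∀ a, M a))
      fun k => LinearMap.range (LinearMap.single A (fun a => M a) (σ k)) := by
  have hind : iSupIndep fun a => LinearMap.range (LinearMap.single A (fun a => M a) a) := by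
    intro a
    have h := LinearMap.disjoint_single_single A (fun a => M a) {a} {a}ᶜ disjoint_compl_right
    rw [iSup_singleton] at h
    exact h
  have : Finite α := Finite.of_equiv _ σ
  refine ⟨hind.comp σ.injective, ?_, fun k => ?_⟩
  · rw [← LinearMap.iSup_range_single A (fun a => M a)]
    exact σ.iSup_comp (g := fun a => LinearMap.range (LinearMap.single A (fun a => M a) a))
  · exact (h (σ k)).congr
      (LinearEquiv.ofInjective _ (Pi.single_injective (M := fun a => M a) (σ k)))

theorem hasNumSummands_pi {α : Type} [Fintype α] {M : α → Mdl A} (h : ∀ a, IsIndec (M a)) :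
    HasNumSummands (ModuleCat.of A (∀ a, M a)) (Fintype.card α) := by
  classical
  exact ⟨_, isDecompOf_pi h (Fintype.equivFin α).symm⟩

theorem isBasicMod_pi {α : Type} [Fintype α] {M : α → Mdl A} (h : ∀ a, IsIndec (M a))
    (h' : ∀ a b, a ≠ b → ¬ ModIso (M a) (M b)) : IsBasicMod (ModuleCat.of A (∀ a, M a)) := by
  classical
  let σ := (Fintype.equivFin α).symm
  refine ⟨_, _, isDecompOf_pi h σ, fun k l hkl => ⟨fun φ => ?_⟩⟩
  refine h' (σ k) (σ l) (σ.injective.ne hkl) ⟨?_⟩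
  exact (LinearEquiv.ofInjective _ (Pi.single_injective (M := fun a => M a) (σ k))).trans
    (φ.trans (LinearEquiv.ofInjective _ (Pi.single_injective (M := fun a => M a) (σ l))).symm)

theorem IsDecompOf.modIso_pi {M : Mdl A} {n : ℕ} {F : Fin n → Submodule A M}
    (h : IsDecompOf M F) : ModIso M (ModuleCat.of A (∀ k, F k)) := by
  have hi := DirectSum.isInternal_submodule_of_iSupIndep_of_iSup_eq_top h.1 h.2.1
  exact ⟨(LinearEquiv.ofBijective (DirectSum.coeLinearMap F) hi).symm.trans
    (DirectSum.linearEquivFunOnFintype A (Fin n) fun k => F k)⟩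

/-- A non-projective module of finite length has a non-projective indecomposable summand. -/
theorem exists_indec_summand_of_not_projective (M : Mdl A) [IsArtinian A M]
    (hM : ¬ Module.Projective A M) :
    ∃ Y : Mdl A, IsIndec Y ∧ ¬ Module.Projective A Y ∧ IsSummand Y M := by
  have key : ∀ N : Submodule A M, ¬ Module.Projective A N →
      ∃ Y : Mdl A, IsIndec Y ∧ ¬ Module.Projective A Y ∧ IsSummand Y (ModuleCat.of A N) := by
    intro N
    induction N using WellFoundedLT.induction with
    | ind N ih =>
    intro hN
    have hnt : Nontrivial N := by
      by_contra h
      rw [not_nontrivial_iff_subsingleton] at h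
      exact hN inferInstance
    have step : ∀ L L' : Submodule A N, IsCompl L L' → L' ≠ ⊥ → ¬ Module.Projective A L →
        ∃ Y : Mdl A, IsIndec Y ∧ ¬ Module.Projective A Y ∧ IsSummand Y (ModuleCat.of A N) := by
      intro L L' hL hL' hp
      have φ := L.equivMapOfInjective N.subtype N.injective_subtype
      have hlt : L.map N.subtype < N := by
        refine lt_of_le_of_ne (Submodule.map_subtype_le N L) fun h => hL' ?_
        have htop : L = ⊤ := by
          rw [eq_top_iff]
          intro x _
          obtain ⟨y, hy, hyx⟩ := h.symm.le x.2
          exact Subtype.ext hyx ▸ hy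
        rw [htop] at hL
        exact eq_bot_of_top_isCompl hL
      obtain ⟨Y, hY, hYp, hYs⟩ := ih _ hlt fun h => hp (Module.Projective.of_equiv φ.symm)
      exact ⟨Y, hY, hYp, (hYs.trans (ModIso.isSummand ⟨φ.symm⟩)).trans (isSummand_of_isCompl hL)⟩
    by_cases hind : IsIndec (ModuleCat.of A N)
    · exact ⟨_, hind, hN, ModIso.isSummand ⟨LinearEquiv.refl A N⟩⟩
    · simp only [IsIndec, not_and, not_forall, not_or] at hind
      obtain ⟨L, L', hL, h1, h2⟩ := hind hnt
      by_cases hp : Module.Projective A L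
      · by_cases hp' : Module.Projective A L'
        · exact absurd (Module.Projective.of_equiv (Submodule.prodEquivOfIsCompl L L' hL)) hN
        · exact step L' L hL.symm h1 hp'
      · exact step L L' hL h2 hp
  obtain ⟨Y, hY, hYp, hYs⟩ := key ⊤ fun h =>
    hM (Module.Projective.of_equiv (Submodule.topEquiv (R := A) (M := M)))
  exact ⟨Y, hY, hYp, hYs.trans (ModIso.isSummand ⟨Submodule.topEquiv⟩)⟩

end Decomposition

section Ext

theorem ext1Vanish_of_projective {P X : Mdl A} [Module.Projective A P] : Ext1Vanish P X :=
  fun _ _ g _ hg _ => Module.projective_lifting_property g LinearMap.id hg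

theorem Ext1Vanish.of_isSummand {M N X : Mdl A} (h : Ext1Vanish M X) (hN : IsSummand N M) :
    Ext1Vanish N X := by
  obtain ⟨i, p, hpi⟩ := hN
  intro E f g hf hg hfg
  obtain ⟨ψ, hψ⟩ := h.lift f g hf hg hfg p
  exact ⟨ψ.comp i, by rw [← LinearMap.comp_assoc, hψ, hpi]⟩

theorem Ext1Vanish.pi {α : Type} [Fintype α] {M : α → Mdl A} {X : Mdl A}
    (h : ∀ a, Ext1Vanish (M a) X) : Ext1Vanish (ModuleCat.of A (∀ a, M a)) X := by
  classical
  intro E f g hf hg hfg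
  choose ψ hψ using fun a => (h a).lift f g hf hg hfg (LinearMap.single A (fun a => M a) a)
  refine ⟨LinearMap.lsum A (fun a => M a) ℕ ψ, LinearMap.pi_ext' fun a => ?_⟩
  refine LinearMap.ext fun x => ?_
  refine (congrArg g (LinearMap.lsum_piSingle A _ ℕ ψ a x)).trans ?_
  exact LinearMap.congr_fun (hψ a) x

/-- `f : P → Q'` is a left approximation of `P` by sums of copies of `Q`. -/
def IsLeftApprox {P Q Q' : Mdl A} (f : P →ₗ[A] Q') : Prop :=
  ∀ h : P →ₗ[A] Q, ∃ g : Q' →ₗ[A] Q, g.comp f = h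

theorem IsLeftApprox.exists_factor {P Q Q' X : Mdl A} [Module.Projective A P] {f : P →ₗ[A] Q'}
    (hf : IsLeftApprox (Q := Q) f) (hX : MemFac Q X) (h : P →ₗ[A] X) :
    ∃ g : Q' →ₗ[A] X, g.comp f = h := by
  obtain ⟨n, q, hq⟩ := hX
  obtain ⟨h', hh'⟩ := Module.projective_lifting_property q h hq
  choose g hg using fun t : Fin n => hf ((LinearMap.proj t).comp h')
  refine ⟨q.comp (LinearMap.pi g), ?_⟩
  rw [LinearMap.comp_assoc, ← hh']
  congr 1
  exact LinearMap.ext fun x => funext fun t => LinearMap.congr_fun (hg t) x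

/-- The cokernel of a left approximation between projective modules is `Ext`-orthogonal
to the modules generated by `Q`. -/
theorem IsLeftApprox.ext1Vanish_coker {P Q Q' X : Mdl A} [Module.Projective A P]
    [Module.Projective A Q'] {f : P →ₗ[A] Q'} (hf : IsLeftApprox (Q := Q) f)
    (hX : MemFac Q X) : Ext1Vanish (ModuleCat.of A (Q' ⧸ LinearMap.range f)) X := by
  intro E i g hi hg hig
  obtain ⟨φ, hφ⟩ :=
    Module.projective_lifting_property g (LinearMap.range f).mkQ hg
  have hker : ∀ x, φ (f x) ∈ LinearMap.range i := fun x => by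
    rw [hig, LinearMap.mem_ker, ← LinearMap.comp_apply, hφ]
    simp
  let h : P →ₗ[A] X := (LinearEquiv.ofInjective i hi).symm.toLinearMap.comp
    ((φ.comp f).codRestrict (LinearMap.range i) hker)
  have hh : ∀ x, i (h x) = φ (f x) := fun x =>
    congrArg Subtype.val ((LinearEquiv.ofInjective i hi).apply_symm_apply ⟨φ (f x), hker x⟩)
  obtain ⟨k, hk⟩ := hf.exists_factor hX h
  have hgi : ∀ x, g (i x) = 0 := fun x => by
    rw [← LinearMap.mem_ker, ← hig]; exact LinearMap.mem_range_self i x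
  refine ⟨(LinearMap.range f).liftQ (φ - i.comp k) ?_, ?_⟩
  · rintro _ ⟨x, rfl⟩
    rw [LinearMap.mem_ker, LinearMap.sub_apply, LinearMap.comp_apply, ← LinearMap.comp_apply k,
      hk, hh, sub_self]
  · refine Submodule.linearMap_qext _ (LinearMap.ext fun x => ?_)
    have : g (φ x) = (LinearMap.range f).mkQ x := LinearMap.congr_fun hφ x
    simp [hgi, this]

theorem exists_isLeftApprox (K : Type) [Field K] [Algebra K A] [Module.Finite K A]
    (P Q : Mdl A) [Module.Finite A P] [Module.Finite A Q] :
    ∃ (m : ℕ) (f : P →ₗ[A] ModuleCat.of A (Fin m → Q)), IsLeftApprox (Q := Q) f := by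
  let _ : Module K P := Module.compHom P (algebraMap K A)
  let _ : Module K Q := Module.compHom Q (algebraMap K A)
  have : IsScalarTower K A P := ⟨fun k a x => by
    rw [Algebra.smul_def, mul_smul]; rfl⟩
  have : IsScalarTower K A Q := ⟨fun k a x => by
    rw [Algebra.smul_def, mul_smul]; rfl⟩
  have : Module.Finite K P := Module.Finite.trans A P
  have : Module.Finite K Q := Module.Finite.trans A Q
  have : SMulCommClass A K Q := IsScalarTower.to_smulCommClass'
  have : Module.Finite K (P →ₗ[A] Q) :=
    Module.Finite.of_injective (LinearMap.restrictScalarsₗ K A P Q K)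
      (LinearMap.restrictScalars_injective K)
  obtain ⟨m, b, hb⟩ := Module.Finite.exists_fin (R := K) (M := P →ₗ[A] Q)
  refine ⟨m, LinearMap.pi b, fun h => ?_⟩
  have hh : h ∈ Submodule.span K (Set.range b) := hb ▸ Submodule.mem_top
  obtain ⟨c, hc⟩ := (Submodule.mem_span_range_iff_exists_fun K).1 hh
  refine ⟨∑ t, c t • LinearMap.proj t, ?_⟩
  rw [← hc]
  ext x
  simp

end Ext

theorem MemFac.prod {M X Y : Mdl A} (hX : MemFac M X) (hY : MemFac M Y) :
    MemFac M (ModuleCat.of A (X × Y)) := by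
  obtain ⟨n, f, hf⟩ := hX
  obtain ⟨m, g, hg⟩ := hY
  refine memFac_of_fintype (α := Fin n ⊕ Fin m)
    ((f.comp (LinearMap.funLeft A M Sum.inl)).prod (g.comp (LinearMap.funLeft A M Sum.inr)))
    fun ⟨x, y⟩ => ?_
  obtain ⟨u, rfl⟩ := hf x
  obtain ⟨v, rfl⟩ := hg y
  exact ⟨Sum.elim u v, rfl⟩

theorem MemFac.sup {M N : Mdl A} {L L' : Submodule A N} (h : MemFac M (ModuleCat.of A L))
    (h' : MemFac M (ModuleCat.of A L')) : MemFac M (ModuleCat.of A ↥(L ⊔ L')) := by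
  refine (h.prod h').of_surjective
    ((Submodule.inclusion le_sup_left).coprod (Submodule.inclusion le_sup_right)) fun ⟨x, hx⟩ => ?_
  obtain ⟨y, hy, z, hz, rfl⟩ := Submodule.mem_sup.1 hx
  exact ⟨(⟨y, hy⟩, ⟨z, hz⟩), rfl⟩

theorem exists_ne_zero_of_pi {α : Type} [Finite α] {M : α → Mdl A} {N : Mdl A}
    (f : (∀ a, M a) →ₗ[A] N) (hf : f ≠ 0) : ∃ (a : α) (g : M a →ₗ[A] N), g ≠ 0 := by
  classical
  by_contra! h
  refine hf (LinearMap.pi_ext' fun a => ?_)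
  rw [LinearMap.zero_comp]
  exact h a _

theorem MemFac.exists_ne_zero {M N : Mdl A} [Nontrivial N] (h : MemFac M N) :
    ∃ g : M →ₗ[A] N, g ≠ 0 := by
  obtain ⟨n, f, hf⟩ := h
  obtain ⟨-, g, hg⟩ := exists_ne_zero_of_pi (M := fun _ : Fin n => M) f fun h => by
    obtain ⟨y, hy⟩ := exists_ne (0 : N)
    obtain ⟨x, rfl⟩ := hf y
    exact hy (by rw [h]; rfl)
  exact ⟨g, hg⟩

end Modules

section Idempotents

variable {Λ : Type} [Ring Λ]

/-- The right module map `Λ → M`, `l ↦ ml`. -/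
def evalAt {M : Mdl Λᵐᵒᵖ} (m : M) : Λ →ₗ[Λᵐᵒᵖ] M where
  toFun l := op l • m
  map_add' a b := by rw [op_add, add_smul]
  map_smul' r l := by
    rw [RingHom.id_apply, ← mul_smul]
    rfl

/-- `Λ` is free of rank one as a right module. -/
def opRegEquiv (Λ : Type) [Ring Λ] : Λᵐᵒᵖ ≃ₗ[Λᵐᵒᵖ] Λ where
  toFun := unop
  invFun := op
  map_add' _ _ := rfl
  map_smul' _ _ := rfl
  left_inv _ := rfl
  right_inv _ := rfl

theorem projective_regMod : Module.Projective Λᵐᵒᵖ Λ := Module.Projective.of_equiv (opRegEquiv Λ)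

theorem finite_regMod : Module.Finite Λᵐᵒᵖ Λ := Module.Finite.equiv (opRegEquiv Λ)

/-- The quotient map `Λ → xΛ`. -/
def projMk (x : Λ) : Λ →ₗ[Λᵐᵒᵖ] projMod Λ x := (rSpan Λ {1 - x}).mkQ

theorem projMk_surjective (x : Λ) : Function.Surjective (projMk x) := Submodule.mkQ_surjective _

instance (x : Λ) : Module.Finite Λᵐᵒᵖ (projMod Λ x) :=
  have := finite_regMod (Λ := Λ)
  Module.Finite.of_surjective _ (projMk_surjective x)

theorem memFac_regMod_projMod (x : Λ) : MemFac (regMod Λ) (projMod Λ x) :=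
  (MemFac.refl _).of_surjective _ (projMk_surjective x)

theorem projMk_mul {x : Λ} (l : Λ) : projMk x (x * l) = projMk x l := by
  rw [eq_comm, ← sub_eq_zero, ← map_sub]
  refine (Submodule.Quotient.mk_eq_zero _).2 (Submodule.mem_span_singleton.2 ⟨op l, ?_⟩)
  rw [op_smul_eq_mul, sub_mul, one_mul]

theorem exists_projMod_hom {x : Λ} (hx : IsIdempotentElem x) {M : Mdl Λᵐᵒᵖ} (m : M) :
    ∃ φ : projMod Λ x →ₗ[Λᵐᵒᵖ] M, ∀ l, φ (projMk x l) = op (x * l) • m := by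
  refine ⟨(rSpan Λ {1 - x}).liftQ (evalAt (op x • m)) ?_, fun l => ?_⟩
  · refine Submodule.span_le.2 (Set.singleton_subset_iff.2 ?_)
    change op (1 - x) • op x • m = 0
    rw [← mul_smul, ← op_mul, mul_sub, mul_one, hx.eq, sub_self, op_zero, zero_smul]
  · change op l • op x • m = _
    rw [← mul_smul, ← op_mul]

theorem exists_projMod_section {x : Λ} (hx : IsIdempotentElem x) :
    ∃ s : projMod Λ x →ₗ[Λᵐᵒᵖ] Λ, ∀ l, s (projMk x l) = x * l := by
  obtain ⟨s, hs⟩ := exists_projMod_hom hx (M := regMod Λ) (1 : Λ)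
  exact ⟨s, fun l => (hs l).trans (one_mul (x * l))⟩

theorem projMk_eq_zero_iff {x : Λ} (hx : IsIdempotentElem x) (l : Λ) :
    projMk x l = 0 ↔ x * l = 0 := by
  constructor
  · intro h
    obtain ⟨s, hs⟩ := exists_projMod_section hx
    rw [← hs, h, map_zero]
  · intro h
    rw [← projMk_mul, h, map_zero]

theorem projective_projMod {x : Λ} (hx : IsIdempotentElem x) :
    Module.Projective Λᵐᵒᵖ (projMod Λ x) := by
  have := projective_regMod (Λ := Λ)
  obtain ⟨s, hs⟩ := exists_projMod_section hx
  refine Module.Projective.of_split s (projMk x) (LinearMap.ext fun y => ?_)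
  obtain ⟨l, rfl⟩ := projMk_surjective x y
  rw [LinearMap.comp_apply, hs, projMk_mul]
  rfl

theorem IsPrimIdem.isIndec {x : Λ} (hx : IsPrimIdem Λ x) : IsIndec (projMod Λ x) := by
  obtain ⟨hi, h0, hprim⟩ := hx
  obtain ⟨s, hs⟩ := exists_projMod_section hi
  have hmk : ∀ y, projMk x (s y) = y := fun y => by
    obtain ⟨l, rfl⟩ := projMk_surjective x y
    rw [hs, projMk_mul]
  have hxs : ∀ y, x * s y = s y := fun y => by
    obtain ⟨l, rfl⟩ := projMk_surjective x y
    rw [hs, ← mul_assoc, hi.eq]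
  refine ⟨⟨projMk x 1, 0, fun h => h0 ?_⟩, fun N N' hN => ?_⟩
  · rw [projMk_eq_zero_iff hi, mul_one] at h
    exact h
  have key : ∀ (N N' : Submodule Λᵐᵒᵖ (projMod Λ x)), Disjoint N N' → ∀ n ∈ N, ∀ n' ∈ N',
      n + n' = projMk x 1 → s n * s n = s n ∧ s n' * s n = 0 := by
    intro N N' hN n hn n' hn' h
    have hsum : s n + s n' = x := by rw [← map_add, h, hs, mul_one]
    have h1 : projMk x (s n' * s n) = op (s n) • n' := by
      rw [← op_smul_eq_mul, map_smul, hmk]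
    have h2 : projMk x (s n * s n) = op (s n) • n := by
      rw [← op_smul_eq_mul, map_smul, hmk]
    have h3 : s n = s n * s n + s n' * s n := by rw [← add_mul, hsum, hxs]
    have h4 : op (s n) • n' = 0 := by
      refine (Submodule.disjoint_def.1 hN) _ ?_ (N'.smul_mem _ hn')
      have : op (s n) • n' = n - op (s n) • n := by
        rw [← h1, ← h2, eq_sub_iff_add_eq', ← map_add, ← h3, hmk]
      rw [this]
      exact N.sub_mem hn (N.smul_mem _ hn)
    have h5 : s n' * s n = 0 := by
      rw [h4, projMk_eq_zero_iff hi, ← mul_assoc, hxs] at h1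
      exact h1
    exact ⟨by rw [h5, add_zero] at h3; exact h3.symm, h5⟩
  have htop : ∀ L : Submodule Λᵐᵒᵖ (projMod Λ x), projMk x 1 ∈ L → L = ⊤ := fun L hL => by
    rw [eq_top_iff]
    intro y _
    obtain ⟨l, rfl⟩ := projMk_surjective x y
    rw [← one_mul l, ← op_smul_eq_mul, map_smul]
    exact L.smul_mem _ hL
  obtain ⟨n, hn, n', hn', h⟩ := Submodule.mem_sup.1
    (hN.sup_eq_top.symm ▸ Submodule.mem_top : projMk x 1 ∈ N ⊔ N')
  obtain ⟨ha, hba⟩ := key N N' hN.disjoint n hn n' hn' h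
  obtain ⟨hb, hab⟩ := key N' N hN.disjoint.symm n' hn' n hn (by rw [add_comm, h])
  rcases hprim _ _ ha hb hab hba (by rw [← map_add, h, hs, mul_one]) with h0 | h0
  · left
    have hn0 : n = 0 := by rw [← hmk n, h0, map_zero]
    rw [hn0, zero_add] at h
    rw [htop N' (h ▸ hn')] at hN
    exact eq_bot_of_isCompl_top hN
  · right
    have hn0 : n' = 0 := by rw [← hmk n', h0, map_zero]
    rw [hn0, add_zero] at h
    rw [htop N (h ▸ hn)] at hN
    exact eq_bot_of_top_isCompl hN

theorem MemFac.supp_subset {ι : Type} {e : ι → Λ} {M N : Mdl Λᵐᵒᵖ} (h : MemFac M N) :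
    Supp Λ e N ⊆ Supp Λ e M := by
  rintro i ⟨y, hy⟩
  obtain ⟨n, f, hf⟩ := h
  obtain ⟨x, rfl⟩ := hf y
  by_contra hi
  have hx : op (e i) • x = 0 := funext fun t => by_contra fun ht => hi ⟨x t, ht⟩
  exact hy (by rw [← map_smul, hx, map_zero])

instance {α : Type} [Finite α] (M : α → Mdl Λᵐᵒᵖ) [∀ a, Module.Projective Λᵐᵒᵖ (M a)] :
    Module.Projective Λᵐᵒᵖ (∀ a, M a) := by
  classical
  cases nonempty_fintype α
  exact Module.Projective.of_equiv (DirectSum.linearEquivFunOnFintype Λᵐᵒᵖ α fun a => M a)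

/-- The projective module `⨁_{k ≠ j} P_k`. -/
abbrev otherProj {ι : Type} (e : ι → Λ) (j : ι) : Mdl Λᵐᵒᵖ :=
  ModuleCat.of Λᵐᵒᵖ (∀ k : {k // k ≠ j}, projMod Λ (e k))

theorem memFac_otherProj_projMod {ι : Type} {e : ι → Λ} {j k : ι} (h : k ≠ j) :
    MemFac (otherProj e j) (projMod Λ (e k)) := by
  classical
  exact (MemFac.refl _).of_surjective
    (LinearMap.proj (R := Λᵐᵒᵖ) (φ := fun k : {k // k ≠ j} => projMod Λ (e k)) ⟨k, h⟩)
    (LinearMap.proj_surjective _)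

variable {ι : Type} [Fintype ι] {e : ι → Λ}

theorem CompletePrimIdems.exists_smul_ne_zero (he : CompletePrimIdems Λ e) {M : Mdl Λᵐᵒᵖ} {m : M}
    (hm : m ≠ 0) : ∃ i, op (e i) • m ≠ 0 := by
  by_contra! h
  refine hm ?_
  have : op (∑ i, e i) • m = 0 := by
    rw [Finset.op_sum, Finset.sum_smul]
    exact Finset.sum_eq_zero fun i _ => h i
  rwa [he.2.2, op_one, one_smul] at this

theorem exists_ne_zero_of_smul_ne_zero {x : Λ} (hx : IsIdempotentElem x) {M : Mdl Λᵐᵒᵖ} {m : M}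
    (hm : op x • m ≠ 0) : ∃ φ : projMod Λ x →ₗ[Λᵐᵒᵖ] M, φ ≠ 0 := by
  obtain ⟨φ, hφ⟩ := exists_projMod_hom hx m
  refine ⟨φ, fun h => hm ?_⟩
  rw [← mul_one x, ← hφ, h, LinearMap.zero_apply]

theorem exists_smul_ne_zero_of_ne_zero {x : Λ} {M : Mdl Λᵐᵒᵖ}
    {φ : projMod Λ x →ₗ[Λᵐᵒᵖ] M} (hφ : φ ≠ 0) : ∃ m : M, op x • m ≠ 0 := by
  by_contra! h
  refine hφ (LinearMap.ext fun y => ?_)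
  obtain ⟨l, rfl⟩ := projMk_surjective x y
  rw [← projMk_mul, show x * l = op l • op x • (1 : Λ) by
    rw [op_smul_eq_mul, op_smul_eq_mul, one_mul], map_smul, map_smul, map_smul, map_smul, h,
    smul_zero]
  rfl

theorem mem_supp_projMod (he : CompletePrimIdems Λ e) (i : ι) : i ∈ Supp Λ e (projMod Λ (e i)) := by
  refine exists_smul_ne_zero_of_ne_zero (φ := LinearMap.id) fun h => ?_
  have := (he.1 i).isIndec.1
  obtain ⟨y, hy⟩ := exists_ne (0 : projMod Λ (e i))
  exact hy (LinearMap.congr_fun h y)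

theorem regMod_modIso_pi (he : CompletePrimIdems Λ e) :
    ModIso (regMod Λ) (ModuleCat.of Λᵐᵒᵖ (∀ i, projMod Λ (e i))) := by
  refine ⟨LinearEquiv.ofBijective (LinearMap.pi fun i => projMk (e i)) ⟨?_, fun v => ?_⟩⟩
  · rw [← LinearMap.ker_eq_bot, LinearMap.ker_eq_bot']
    intro l hl
    have : ∀ i, e i * l = 0 := fun i =>
      (projMk_eq_zero_iff (he.1 i).1 l).1 (congrFun hl i)
    rw [← one_mul (l : Λ), ← he.2.2, Finset.sum_mul]
    exact Finset.sum_eq_zero fun i _ => this i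
  · choose a ha using fun i => projMk_surjective (e i) (v i)
    refine ⟨∑ i, e i * a i, funext fun k => ?_⟩
    change projMk (e k) (∑ i, e i * a i) = v k
    rw [← projMk_mul, Finset.mul_sum, Finset.sum_eq_single k, projMk_mul, projMk_mul, ha]
    · intro i _ hik
      rw [← mul_assoc, he.2.1 hik.symm, zero_mul]
    · simp

section Artinian

variable [IsArtinianRing Λᵐᵒᵖ]

/-- A simple module is supported at a single vertex. -/
theorem eq_of_smul_ne_zero (he : CompletePrimIdems Λ e) (hb : IsBasicAlg Λ e) {S : Mdl Λᵐᵒᵖ}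
    [IsSimpleModule Λᵐᵒᵖ S] {i k : ι} {s t : S} (hs : op (e i) • s ≠ 0) (ht : op (e k) • t ≠ 0) :
    i = k := by
  obtain ⟨φ, hφ⟩ := exists_ne_zero_of_smul_ne_zero (he.1 i).1 hs
  obtain ⟨ψ, hψ⟩ := exists_ne_zero_of_smul_ne_zero (he.1 k).1 ht
  have := projective_projMod (he.1 i).1
  have := projective_projMod (he.1 k).1
  by_contra hik
  exact not_nonempty_iff.2 (hb i k hik)
    (modIso_of_common_simple_quotient (he.1 i).isIndec (he.1 k).isIndec φ ψ hφ hψ)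

/-- Simple modules supported at the same vertex are isomorphic. -/
theorem modIso_of_smul_ne_zero (he : CompletePrimIdems Λ e) {S S' : Mdl Λᵐᵒᵖ}
    [IsSimpleModule Λᵐᵒᵖ S] [IsSimpleModule Λᵐᵒᵖ S'] {i : ι} {s : S} {t : S'}
    (hs : op (e i) • s ≠ 0) (ht : op (e i) • t ≠ 0) : ModIso S S' := by
  obtain ⟨φ, hφ⟩ := exists_ne_zero_of_smul_ne_zero (he.1 i).1 hs
  obtain ⟨ψ, hψ⟩ := exists_ne_zero_of_smul_ne_zero (he.1 i).1 ht
  have := projective_projMod (he.1 i).1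
  have := (he.1 i).isIndec.isLocalRing
  exact modIso_of_simple_quotients φ ψ hφ hψ

/-- The simple module at the vertex `i` is a quotient of `X_i`. -/
theorem memFac_cyclicQuot (he : CompletePrimIdems Λ e) (hb : IsBasicAlg Λ e) {S : Mdl Λᵐᵒᵖ}
    [IsSimpleModule Λᵐᵒᵖ S] {i : ι} {s : S} (hs : op (e i) • s ≠ 0) :
    MemFac (cyclicQuot Λ (e i)) S := by
  have hone : ∀ t : S, op (e i) • t = t := fun t => by
    have h : op (∑ k, e k) • t = op (e i) • t := by
      rw [Finset.op_sum, Finset.sum_smul]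
      refine Finset.sum_eq_single i (fun k _ hk => ?_) (by simp)
      by_contra ht
      exact hk (eq_of_smul_ne_zero he hb ht hs)
    rwa [he.2.2, op_one, one_smul, eq_comm] at h
  have hle : tIdeal Λ (1 - e i) ≤ LinearMap.ker (evalAt s) := by
    refine Submodule.span_le.2 ?_
    rintro _ ⟨a, rfl⟩
    change op (a * (1 - e i)) • s = 0
    rw [op_mul, mul_smul, op_sub, op_one, sub_smul, one_smul, hone, sub_self]
  refine (MemFac.refl _).of_surjective ((tIdeal Λ (1 - e i)).liftQ (evalAt s) hle)
    (LinearMap.surjective_of_ne_zero fun h => hs ?_)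
  exact LinearMap.congr_fun h ((tIdeal Λ (1 - e i)).mkQ (e i))

theorem memFac_otherProj_of_forall_simple (he : CompletePrimIdems Λ e) {j : ι} {X : Mdl Λᵐᵒᵖ}
    [Module.Finite Λᵐᵒᵖ X]
    (hX : ∀ S : Mdl Λᵐᵒᵖ, IsSimpleModule Λᵐᵒᵖ S → MemFac X S → ∀ s : S, op (e j) • s = 0) :
    MemFac (otherProj e j) X := by
  obtain ⟨L, hL, hmax⟩ := WellFounded.has_min (wellFounded_gt (α := Submodule Λᵐᵒᵖ X))
    {L | MemFac (otherProj e j) (ModuleCat.of Λᵐᵒᵖ L)}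
    ⟨⊥, 0, 0, fun x => ⟨0, Subsingleton.elim (α := (⊥ : Submodule Λᵐᵒᵖ X)) _ _⟩⟩
  rcases eq_top_or_exists_le_coatom L with rfl | ⟨N, hN, hLN⟩
  · exact MemFac.of_surjective hL (Submodule.topEquiv (R := Λᵐᵒᵖ) (M := X)).toLinearMap
      (LinearEquiv.surjective _)
  exfalso
  let S : Mdl Λᵐᵒᵖ := ModuleCat.of Λᵐᵒᵖ (X ⧸ N)
  have hS : IsSimpleModule Λᵐᵒᵖ S := isSimpleModule_iff_isCoatom.2 hN
  have hXS : MemFac X S := (MemFac.refl X).of_surjective N.mkQ N.mkQ_surjective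
  have := IsSimpleModule.nontrivial Λᵐᵒᵖ S
  obtain ⟨s, hs⟩ := exists_ne (0 : S)
  obtain ⟨k, hk⟩ := he.exists_smul_ne_zero hs
  have hkj : k ≠ j := by
    rintro rfl
    exact hk (hX S hS hXS s)
  obtain ⟨x, rfl⟩ := N.mkQ_surjective s
  obtain ⟨φ, hφ⟩ := exists_projMod_hom (he.1 k).1 x
  have hr : MemFac (otherProj e j) (ModuleCat.of Λᵐᵒᵖ (LinearMap.range φ)) :=
    (memFac_otherProj_projMod hkj).of_surjective φ.rangeRestrict φ.surjective_rangeRestrict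
  refine hmax _ (MemFac.sup hL hr) (lt_of_le_of_ne le_sup_left fun h => hk ?_)
  have hx : op (e k) • x ∈ L := by
    rw [h]
    refine Submodule.mem_sup_right ⟨projMk (e k) 1, ?_⟩
    rw [hφ, mul_one]
  exact (Submodule.Quotient.mk_eq_zero N).2 (hLN hx)

theorem not_memFac_otherProj (he : CompletePrimIdems Λ e) (hb : IsBasicAlg Λ e) {S : Mdl Λᵐᵒᵖ}
    [IsSimpleModule Λᵐᵒᵖ S] {j : ι} {s : S} (hs : op (e j) • s ≠ 0) :
    ¬ MemFac (otherProj e j) S := by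
  intro h
  have := IsSimpleModule.nontrivial Λᵐᵒᵖ S
  obtain ⟨g, hg⟩ := h.exists_ne_zero
  obtain ⟨k, φ, hφ⟩ := exists_ne_zero_of_pi (M := fun k : {k // k ≠ j} => projMod Λ (e k)) g hg
  obtain ⟨t, ht⟩ := exists_smul_ne_zero_of_ne_zero hφ
  exact k.2 (eq_of_smul_ne_zero he hb ht hs)

theorem not_isSummand_otherProj_pow (he : CompletePrimIdems Λ e) (hb : IsBasicAlg Λ e) (j : ι)
    (n : ℕ) : ¬ IsSummand (projMod Λ (e j)) (ModuleCat.of Λᵐᵒᵖ (Fin n → otherProj e j)) := by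
  intro h
  have := (he.1 j).isIndec.isLocalRing
  have := (he.1 j).isIndec.1
  classical
  obtain ⟨-, h⟩ := IsSummand.exists_of_pi (M := fun _ : Fin n => otherProj e j) h
  obtain ⟨k, h⟩ := IsSummand.exists_of_pi (M := fun k : {k // k ≠ j} => projMod Λ (e k)) h
  exact not_nonempty_iff.2 (hb j k k.2.symm) (h.modIso (he.1 k).isIndec)

theorem not_projective_coker (he : CompletePrimIdems Λ e) (hb : IsBasicAlg Λ e) {j : ι} {m : ℕ}
    {f : projMod Λ (e j) →ₗ[Λᵐᵒᵖ] ModuleCat.of Λᵐᵒᵖ (Fin m → otherProj e j)} (hf : f ≠ 0) :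
    ¬ Module.Projective Λᵐᵒᵖ ((Fin m → otherProj e j) ⧸ LinearMap.range f) := by
  intro hC
  have := fun k => projective_projMod (he.1 k).1
  have := (he.1 j).isIndec.1
  let q := (LinearMap.range f).mkQ
  obtain ⟨s, hs⟩ := Module.projective_lifting_property q LinearMap.id (Submodule.mkQ_surjective _)
  have hc := isCompl_range_ker (M := ModuleCat.of Λᵐᵒᵖ (Fin m → otherProj e j))
    (N := ModuleCat.of Λᵐᵒᵖ ((Fin m → otherProj e j) ⧸ LinearMap.range f)) hs
  rw [Submodule.ker_mkQ] at hc
  have hsum := isSummand_of_isCompl hc.symm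
  have hproj : Module.Projective Λᵐᵒᵖ (LinearMap.range f) := by
    obtain ⟨i, p, hip⟩ := hsum
    exact Module.Projective.of_split i p hip
  obtain ⟨t, ht⟩ := Module.projective_lifting_property f.rangeRestrict LinearMap.id
    f.surjective_rangeRestrict
  have hsum' : IsSummand (ModuleCat.of Λᵐᵒᵖ (LinearMap.range f)) (projMod Λ (e j)) :=
    ⟨t, f.rangeRestrict, ht⟩
  have : Nontrivial (ModuleCat.of Λᵐᵒᵖ (LinearMap.range f)) :=
    Submodule.nontrivial_iff_ne_bot.2 fun h => hf (LinearMap.range_eq_bot.1 h)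
  obtain ⟨φ⟩ := hsum'.modIso (he.1 j).isIndec
  exact not_isSummand_otherProj_pow he hb j m (ModIso.isSummand ⟨φ.symm⟩ |>.trans hsum)

/-- The torsion class `Fac ⨁_{k ≠ j} P_k` is generated by a basic support τ-tilting module. -/
theorem exists_isBSTT_otherProj (K : Type) [Field K] [Algebra K Λᵐᵒᵖ] [Module.Finite K Λᵐᵒᵖ]
    (he : CompletePrimIdems Λ e) (hb : IsBasicAlg Λ e) (j : ι) :
    ∃ W, IsBSTT Λ e W ∧ MemFac W (otherProj e j) ∧ MemFac (otherProj e j) W := by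
  classical
  have hproj := fun k => projective_projMod (he.1 k).1
  have hniso : ∀ a b : {k // k ≠ j}, a ≠ b → ¬ ModIso (projMod Λ (e a)) (projMod Λ (e b)) :=
    fun a b hab => not_nonempty_iff.2 (hb a b fun h => hab (Subtype.ext h))
  have hsupp : ∀ k ≠ j, k ∈ Supp Λ e (otherProj e j) := fun k hk =>
    (memFac_otherProj_projMod hk).supp_subset (mem_supp_projMod he k)
  by_cases hj : j ∈ Supp Λ e (otherProj e j)
  · obtain ⟨m, f, hf⟩ := exists_isLeftApprox K (projMod Λ (e j)) (otherProj e j)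
    have hf0 : f ≠ 0 := by
      rintro rfl
      obtain ⟨y, hy⟩ := hj
      obtain ⟨h, hh⟩ := exists_ne_zero_of_smul_ne_zero (he.1 j).1 hy
      obtain ⟨g, rfl⟩ := hf h
      exact hh (LinearMap.comp_zero g)
    let C : Mdl Λᵐᵒᵖ := ModuleCat.of Λᵐᵒᵖ ((Fin m → otherProj e j) ⧸ LinearMap.range f)
    obtain ⟨Y, hY, hYproj, hYC⟩ :=
      exists_indec_summand_of_not_projective C (not_projective_coker he hb hf0)
    have hQY : MemFac (otherProj e j) Y := by
      refine MemFac.trans ?_ hYC.memFac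
      exact (MemFac.pi fun _ : Fin m => MemFac.refl (otherProj e j)).of_surjective
        (LinearMap.range f).mkQ (Submodule.mkQ_surjective _)
    have hYfin : Module.Finite Λᵐᵒᵖ Y := hQY.finite
    let M : Option {k // k ≠ j} → Mdl Λᵐᵒᵖ := fun a => a.elim Y fun k => projMod Λ (e k)
    let W : Mdl Λᵐᵒᵖ := ModuleCat.of Λᵐᵒᵖ (∀ a, M a)
    have hWQ : MemFac W (otherProj e j) := by
      refine (MemFac.refl W).of_surjective
        (LinearMap.pi fun k : {k // k ≠ j} => LinearMap.proj (φ := fun a => M a) (some k))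
        fun v => ?_
      exact ⟨fun a => Option.rec (motive := fun a => M a) 0 v a, rfl⟩
    have hQW : MemFac (otherProj e j) W :=
      MemFac.pi fun a => Option.rec (motive := fun a => MemFac (otherProj e j) (M a)) hQY
        (fun k => memFac_otherProj_projMod k.2) a
    have hWfin : Module.Finite Λᵐᵒᵖ W := hQW.finite
    have hind : ∀ a, IsIndec (M a) := fun a =>
      Option.rec (motive := fun a => IsIndec (M a)) hY (fun k => (he.1 k).isIndec) a
    have hMproj : ∀ k, Module.Projective Λᵐᵒᵖ (M (some k)) := fun k => hproj k
    have hsuppW : Supp Λ e W = Set.univ := Set.eq_univ_of_forall fun k => by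
      refine hWQ.supp_subset ?_
      by_cases hk : k = j
      · rwa [hk]
      · exact hsupp k hk
    have hcard : (Supp Λ e W).ncard = Fintype.card (Option {k // k ≠ j}) := by
      rw [hsuppW, Set.ncard_univ, Nat.card_eq_fintype_card, Fintype.card_option,
        Fintype.card_subtype_compl, Fintype.card_subtype_eq]
      have : 0 < Fintype.card ι := Fintype.card_pos_iff.2 ⟨j⟩
      omega
    refine ⟨W, ⟨⟨hWfin, ⟨hWfin, fun X hX => ?_⟩, hcard ▸ hasNumSummands_pi hind⟩, ?_⟩, hWQ, hQW⟩
    · have hX' := hQW.trans hX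
      refine Ext1Vanish.pi fun a => ?_
      cases a with
      | none => exact (hf.ext1Vanish_coker hX').of_isSummand hYC
      | some k => have := hMproj k; exact ext1Vanish_of_projective
    · refine isBasicMod_pi hind fun a b hab => ?_
      cases a with
      | none =>
        cases b with
        | none => exact absurd rfl hab
        | some k => have := hMproj k; exact fun ⟨φ⟩ => hYproj (Module.Projective.of_equiv φ.symm)
      | some k =>
        cases b with
        | none => have := hMproj k; exact fun ⟨φ⟩ => hYproj (Module.Projective.of_equiv φ)
        | some l => exact hniso k l fun h => hab (by rw [h])
  · have hcard : (Supp Λ e (otherProj e j)).ncard = Fintype.card {k // k ≠ j} := by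
      rw [← Nat.card_eq_fintype_card, ← Nat.card_coe_set_eq]
      refine congrArg Nat.card (congrArg Subtype (funext fun k => propext ⟨?_, hsupp k⟩))
      rintro hk rfl
      exact hj hk
    refine ⟨otherProj e j, ⟨⟨inferInstance, ⟨inferInstance, fun _ _ => ext1Vanish_of_projective⟩,
      ?_⟩, isBasicMod_pi (fun k => (he.1 k).isIndec) hniso⟩, MemFac.refl _, MemFac.refl _⟩
    exact hcard ▸ hasNumSummands_pi fun k => (he.1 k).isIndec

theorem memFac_otherProj_of_hArrow (K : Type) [Field K] [Algebra K Λᵐᵒᵖ] [Module.Finite K Λᵐᵒᵖ]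
    (he : CompletePrimIdems Λ e) (hb : IsBasicAlg Λ e) {Z : Mdl Λᵐᵒᵖ}
    (hZ : HArrow (IsBSTT Λ e) (regMod Λ) Z) {i : ι} (hi : ¬ InAdd (projMod Λ (e i)) Z) :
    MemFac (otherProj e i) Z := by
  obtain ⟨-, hZT, hlt, hcov⟩ := hZ
  have := hZT.1.1
  have : Module.Finite Λᵐᵒᵖ (regMod Λ) := finite_regMod
  have := projective_projMod (he.1 i).1
  obtain ⟨S, hS, hZS⟩ : ∃ S : Mdl Λᵐᵒᵖ, IsSimpleModule Λᵐᵒᵖ S ∧ ¬ MemFac Z S := by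
    by_contra! h
    exact hlt.2 (hZT.1.2.1.memFac_of_forall_simple h (regMod Λ)).facLE
  have := IsSimpleModule.nontrivial Λᵐᵒᵖ S
  obtain ⟨s, hs⟩ := exists_ne (0 : S)
  obtain ⟨j, hj⟩ := he.exists_smul_ne_zero hs
  have hQZ : MemFac (otherProj e j) Z := by
    refine memFac_otherProj_of_forall_simple he fun S' hS' hZS' t => ?_
    by_contra ht
    exact hZS (hZS'.trans (modIso_of_smul_ne_zero he hj ht).isSummand.memFac)
  obtain ⟨W, hW, hWQ, hQW⟩ := exists_isBSTT_otherProj K he hb j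
  have hWlt : FacLT W (regMod Λ) := by
    classical
    refine ⟨((MemFac.pi fun k => memFac_regMod_projMod _).trans hQW).facLE, fun h => ?_⟩
    have hΛS : MemFac (regMod Λ) S := by
      refine (MemFac.refl _).of_surjective (evalAt s)
        (LinearMap.surjective_of_ne_zero fun h => hj (LinearMap.congr_fun h (e j)))
    exact not_memFac_otherProj he hb hj (hQW.trans (h S hΛS))
  have hZQ : MemFac Z (otherProj e j) := by
    by_contra h
    exact hcov W hW ⟨(hWQ.trans hQZ).facLE, fun h' => h (h' _ hWQ)⟩ hWlt
  by_cases hij : i = j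
  · rwa [hij]
  · exact absurd (hZQ.trans (memFac_otherProj_projMod hij)).isSummand hi

theorem modIso_regMod_of_memFac (he : CompletePrimIdems Λ e) (hb : IsBasicAlg Λ e) {T : Mdl Λᵐᵒᵖ}
    {m : ℕ} (hT : HasNumSummands T m) (hm : m ≤ Fintype.card ι)
    (h : ∀ i, MemFac T (projMod Λ (e i))) : ModIso T (regMod Λ) := by
  obtain ⟨F, hF⟩ := hT
  obtain ⟨Φ⟩ := hF.modIso_pi
  have key : ∀ i, ∃ k, ModIso (projMod Λ (e i)) (ModuleCat.of Λᵐᵒᵖ (F k)) := by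
    intro i
    have := projective_projMod (he.1 i).1
    have := (he.1 i).isIndec.isLocalRing
    have := (he.1 i).isIndec.1
    obtain ⟨n, hn⟩ := (h i).isSummand
    obtain ⟨-, hn⟩ := IsSummand.exists_of_pi (M := fun _ : Fin n => T) hn
    obtain ⟨k, hk⟩ := IsSummand.exists_of_pi (M := fun k => ModuleCat.of Λᵐᵒᵖ (F k))
      (hn.trans (ModIso.isSummand ⟨Φ⟩))
    exact ⟨k, hk.modIso (hF.2.2 k)⟩
  choose σ φ using key
  have hσ : Function.Injective σ := fun i k hik => by
    by_contra hne
    obtain ⟨α⟩ := φ i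
    obtain ⟨β⟩ := φ k
    rw [← hik] at β
    exact (hb i k hne).false (α.trans β.symm)
  have hbij : Function.Bijective σ := (Fintype.bijective_iff_injective_and_card σ).2
    ⟨hσ, le_antisymm (Fintype.card_le_of_injective σ hσ) (by simpa using hm)⟩
  obtain ⟨Ψ⟩ := regMod_modIso_pi he
  exact ⟨Φ.trans ((LinearEquiv.piCongrLeft Λᵐᵒᵖ (fun k => F k)
    (Equiv.ofBijective σ hbij)).symm.trans
    ((LinearEquiv.piCongrRight fun i => (φ i).some.symm).trans Ψ.symm))⟩

end Artinian

end Idempotents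

end TauTilting

open TauTilting in
/-- Let `T` be a basic support τ-tilting `Λ`-module.
(1) If `T ≤ Z_i` for every `i ∈ Q₀`, then `T = 0`.
(2) If `T ≥ X_i` for every `i ∈ Q₀`, then `T = Λ`.
Here `X_i = Λ/(1-e_i)` and `Z_i` is the unique direct successor of `Λ` in the
Hasse quiver of `sτtilt Λ` not having `P_i` as a direct summand. -/
theorem statement1
    (K : Type) [Field K]
    (Λ : Type) [Ring Λ] [Algebra K Λ] [FiniteDimensional K Λ]
    (ι : Type) [Fintype ι] (e : ι → Λ)
    (he : CompletePrimIdems Λ e) (hbasic : IsBasicAlg Λ e)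
    (Z : ι → Mdl Λᵐᵒᵖ)
    (hZ : ∀ i, HArrow (IsBSTT Λ e) (regMod Λ) (Z i) ∧ ¬ InAdd (projMod Λ (e i)) (Z i))
    (T : Mdl Λᵐᵒᵖ) (hT : IsBSTT Λ e T) :
    ((∀ i, FacLE T (Z i)) → Subsingleton T) ∧
    ((∀ i, FacLE (cyclicQuot Λ (e i)) T) → ModIso T (regMod Λ)) := by
  have : Module.Finite K Λᵐᵒᵖ := Module.Finite.equiv (MulOpposite.opLinearEquiv K)
  have : IsArtinianRing Λᵐᵒᵖ := IsArtinianRing.of_finite K Λᵐᵒᵖ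
  have := hT.1.1
  constructor
  · intro h
    by_contra hne
    have : Nontrivial T := not_subsingleton_iff_nontrivial.1 hne
    obtain ⟨S, p, hS, hp⟩ := exists_simple_quotient T
    have := IsSimpleModule.nontrivial Λᵐᵒᵖ S
    obtain ⟨s, hs⟩ := exists_ne (0 : S)
    obtain ⟨i, hi⟩ := he.exists_smul_ne_zero hs
    have hZi := memFac_otherProj_of_hArrow K he hbasic (hZ i).1 (hZ i).2
    exact not_memFac_otherProj he hbasic hi
      (hZi.trans (h i S ((MemFac.refl T).of_surjective p hp)))
  · intro h
    refine modIso_regMod_of_memFac he hbasic hT.1.2.2 ?_ fun i => ?_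
    · rw [← Nat.card_eq_fintype_card]
      exact Set.ncard_le_card _
    · refine hT.1.2.1.memFac_of_forall_simple (fun S hS => ?_) (projMod Λ (e i))
      have := IsSimpleModule.nontrivial Λᵐᵒᵖ S
      obtain ⟨s, hs⟩ := exists_ne (0 : S)
      obtain ⟨k, hk⟩ := he.exists_smul_ne_zero hs
      exact h k S (memFac_cyclicQuot he hbasic hk)
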